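/- Let A be a type and m : A → A → A → A a Mal'cev operation that commutes with itself. Let t : A → A → A be any binary operation commuting with m. Define r a b := m (t a b) (t b b) b and u b := t b b. Then: (i) r commutes with m and is idempotent (r b b = b for all b); (ii) u commutes with m; (iii) t a b = m (r a b) b (u b) for all a, b ∈ A; and (iv) this decomposition is unique: if r' is idempotent and commutes with m, u' commutes with m, and t a b = m (r' a b) b (u' b) for all a, b, then r' = r and u' = u. -/

import Mathlib

/-- A binary operation `t` commutes with the ternary operation `m`. -/
def CommutesBin {A : Type*} (m : A → A → A → A) (t : A → A → A) : Prop :=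
  ∀ x₁ x₂ y₁ y₂ z₁ z₂ : A,
    t (m x₁ y₁ z₁) (m x₂ y₂ z₂) = m (t x₁ x₂) (t y₁ y₂) (t z₁ z₂)

/-- A unary operation `u` commutes with the ternary operation `m`. -/
def CommutesUn {A : Type*} (m : A → A → A → A) (u : A → A) : Prop :=
  ∀ x y z : A, u (m x y z) = m (u x) (u y) (u z)

/-- In a self-commuting Mal'cev operation, `x ↦ m x c b` is inverse to `x ↦ m x b c`. -/
theorem malcev_cancel {A : Type*} (m : A → A → A → A)
    (hm : ∀ x y : A, m x x y = y ∧ m y x x = y)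
    (hself : ∀ x₁ x₂ x₃ y₁ y₂ y₃ z₁ z₂ z₃ : A,
      m (m x₁ x₂ x₃) (m y₁ y₂ y₃) (m z₁ z₂ z₃)
        = m (m x₁ y₁ z₁) (m x₂ y₂ z₂) (m x₃ y₃ z₃))
    (a b c : A) : m (m a c b) b c = a := by
  have h := hself a c b c c b c b b
  rwa [(hm c b).1, (hm b c).2, (hm c a).2, (hm b b).1, (hm b a).2] at h

/-- Every binary operation `t` commuting with a self-commuting
Mal'cev operation `m` decomposes uniquely as
`t a b = m (r a b) b (u b)` with `r a b := m (t a b) (t b b) b` idempotent and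
commuting with `m`, and `u b := t b b` commuting with `m`. -/
theorem stmt6 {A : Type*} (m : A → A → A → A)
    (hm : ∀ x y : A, m x x y = y ∧ m y x x = y)
    (hself : ∀ x₁ x₂ x₃ y₁ y₂ y₃ z₁ z₂ z₃ : A,
      m (m x₁ x₂ x₃) (m y₁ y₂ y₃) (m z₁ z₂ z₃)
        = m (m x₁ y₁ z₁) (m x₂ y₂ z₂) (m x₃ y₃ z₃))
    (t : A → A → A) (ht : CommutesBin m t) :
    let r : A → A → A := fun a b => m (t a b) (t b b) b
    let u : A → A := fun b => t b b
    (CommutesBin m r ∧ ∀ b : A, r b b = b) ∧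
    CommutesUn m u ∧
    (∀ a b : A, t a b = m (r a b) b (u b)) ∧
    (∀ (r' : A → A → A) (u' : A → A),
      CommutesBin m r' → (∀ b : A, r' b b = b) → CommutesUn m u' →
      (∀ a b : A, t a b = m (r' a b) b (u' b)) → r' = r ∧ u' = u) := by
  intro r u
  refine ⟨⟨fun x₁ x₂ y₁ y₂ z₁ z₂ => ?_, fun b => (hm _ _).1⟩, fun x y z => ht x x y y z z,
    fun a b => (malcev_cancel m hm hself _ _ _).symm, fun r' u' _ hr' _ h => ?_⟩
  · simp only [r]
    rw [ht, ht, hself]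
  · have hu : ∀ b, t b b = u' b := fun b => by rw [h, hr', (hm _ _).1]
    refine ⟨funext₂ fun a b => ?_, funext fun b => (hu b).symm⟩
    simp only [r]
    rw [hu, h, malcev_cancel m hm hself]
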